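/- arXiv:2602.10911 — 4 statements merged into one kernel-verified Lean document; each statement's English description precedes it below -/
import Mathlib

section
/- Fix integers d ≥ 1, S ≥ 1, N ≥ 1 and a burn-in parameter m with 0 ≤ m ≤ N−1. Let y^d_{j|i}, y*_{j|i}, y∞_{j|i}, ŷ_{j|i} ∈ ℝ^d (for i ∈ {1,…,S}, j ∈ {1,…,N}) and real constants r_Y, r_d ≥ 0, C > 0, λ ∈ (0,1), h̄ ≥ 0 satisfy: (i) ‖y*_{j|i}‖ ≤ r_Y, ‖ŷ_{j|i}‖ ≤ r_Y, ‖y∞_{j|i}‖ ≤ r_Y and ‖y^d_{j|i}‖ ≤ r_d for all i, j; (ii) ‖ŷ_{j|i} − y∞_{j|i}‖ ≤ C·λ^j·h̄ for all i, j; (iii) ∑_{i=1}^S ∑_{j=m+1}^N ‖y*_{j|i} − y^d_{j|i}‖² ≤ ∑_{i=1}^S ∑_{j=m+1}^N ‖ŷ_{j|i} − y^d_{j|i}‖². Then ∑_{i=1}^S ∑_{j=m+1}^N ( ‖y*_{j|i} − y^d_{j|i}‖² − ‖y∞_{j|i} − y^d_{j|i}‖² ) ≤ C̄·S·λ^m,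 where C̄ := 2(r_Y + r_d)·C·h̄·λ/(1−λ). -/
/-- Squared distances to a common point differ by at most the distance of the two points times
a bound on the sum of the distances. -/
lemma sq_norm_sub_sub_sq_norm_sub_le {E : Type*} [SeminormedAddCommGroup E] {x y z : E}
    {r s : ℝ} (hx : ‖x‖ ≤ r) (hy : ‖y‖ ≤ r) (hz : ‖z‖ ≤ s) :
    ‖x - z‖ ^ 2 - ‖y - z‖ ^ 2 ≤ 2 * (r + s) * ‖x - y‖ := by
  have hxz : ‖x - z‖ ≤ r + s := (norm_sub_le x z).trans (add_le_add hx hz)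
  have hyz : ‖y - z‖ ≤ r + s := (norm_sub_le y z).trans (add_le_add hy hz)
  have hdiff : ‖x - z‖ - ‖y - z‖ ≤ ‖x - y‖ := by
    simpa using norm_sub_norm_le (x - z) (y - z)
  calc ‖x - z‖ ^ 2 - ‖y - z‖ ^ 2 = (‖x - z‖ + ‖y - z‖) * (‖x - z‖ - ‖y - z‖) := by ring
    _ ≤ (‖x - z‖ + ‖y - z‖) * ‖x - y‖ := by gcongr
    _ ≤ 2 * (r + s) * ‖x - y‖ := by gcongr; linarith

/-- A geometric sum starting after index `m` is bounded by the full geometric tail. -/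
lemma geom_sum_Icc_succ_le {x : ℝ} (h₀ : 0 ≤ x) (h₁ : x < 1) (m n : ℕ) :
    ∑ j ∈ Finset.Icc (m + 1) n, x ^ j ≤ x ^ (m + 1) / (1 - x) := by
  have hIcc : Finset.Icc (m + 1) n = Finset.Ico (m + 1) (n + 1) := by
    ext j
    simp only [Finset.mem_Icc, Finset.mem_Ico]
    omega
  rw [hIcc]
  exact geom_sum_Ico_le_of_lt_one h₀ h₁

/-- **Stabilizability lemma (Lemma 1).**
`ystar j i`, `yinf j i`, `yhat j i`, `yd j i` are the TBPTT-optimal, unconstrained-optimal,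
candidate, and data outputs `y_{j|i}` in `ℝ^d`.  Under boundedness (i), exponential
convergence of the candidate to the unconstrained optimum (ii), and optimality of `ystar`
against the candidate (iii), the excess cost of `ystar` over `yinf` is bounded by
`C̄ S λ^m` with `C̄ = 2(r_Y + r_d) C h̄ λ / (1 - λ)`. -/
theorem stabilizability
    (d S N m : ℕ) (hd : 1 ≤ d) (hS : 1 ≤ S) (hN : 1 ≤ N) (hm : m ≤ N - 1)
    (yd ystar yinf yhat : ℕ → ℕ → EuclideanSpace ℝ (Fin d))
    (rY rd C lam hbar : ℝ) (hrY : 0 ≤ rY) (hrd : 0 ≤ rd) (hC : 0 < C)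
    (hlam : lam ∈ Set.Ioo (0 : ℝ) 1) (hhbar : 0 ≤ hbar)
    (hbound : ∀ i ∈ Finset.Icc 1 S, ∀ j ∈ Finset.Icc 1 N,
      ‖ystar j i‖ ≤ rY ∧ ‖yhat j i‖ ≤ rY ∧ ‖yinf j i‖ ≤ rY ∧ ‖yd j i‖ ≤ rd)
    (hconv : ∀ i ∈ Finset.Icc 1 S, ∀ j ∈ Finset.Icc 1 N,
      ‖yhat j i - yinf j i‖ ≤ C * lam ^ j * hbar)
    (hopt : ∑ i ∈ Finset.Icc 1 S, ∑ j ∈ Finset.Icc (m + 1) N, ‖ystar j i - yd j i‖ ^ 2 ≤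
            ∑ i ∈ Finset.Icc 1 S, ∑ j ∈ Finset.Icc (m + 1) N, ‖yhat j i - yd j i‖ ^ 2) :
    ∑ i ∈ Finset.Icc 1 S, ∑ j ∈ Finset.Icc (m + 1) N,
        (‖ystar j i - yd j i‖ ^ 2 - ‖yinf j i - yd j i‖ ^ 2) ≤
      (2 * (rY + rd) * C * hbar * lam / (1 - lam)) * S * lam ^ m := by
  obtain ⟨hlam₀, hlam₁⟩ := hlam
  have hterm : ∀ i ∈ Finset.Icc 1 S, ∀ j ∈ Finset.Icc (m + 1) N,
      ‖yhat j i - yd j i‖ ^ 2 - ‖yinf j i - yd j i‖ ^ 2 ≤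
        2 * (rY + rd) * C * hbar * lam ^ j := by
    intro i hi j hj
    have hj' : j ∈ Finset.Icc 1 N := Finset.Icc_subset_Icc_left (Nat.le_add_left 1 m) hj
    obtain ⟨-, hhat, hinf, hdata⟩ := hbound i hi j hj'
    calc ‖yhat j i - yd j i‖ ^ 2 - ‖yinf j i - yd j i‖ ^ 2
        ≤ 2 * (rY + rd) * ‖yhat j i - yinf j i‖ :=
          sq_norm_sub_sub_sq_norm_sub_le hhat hinf hdata
      _ ≤ 2 * (rY + rd) * (C * lam ^ j * hbar) := by
          gcongr
          exact hconv i hi j hj'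
      _ = 2 * (rY + rd) * C * hbar * lam ^ j := by ring
  calc ∑ i ∈ Finset.Icc 1 S, ∑ j ∈ Finset.Icc (m + 1) N,
        (‖ystar j i - yd j i‖ ^ 2 - ‖yinf j i - yd j i‖ ^ 2)
      ≤ ∑ i ∈ Finset.Icc 1 S, ∑ j ∈ Finset.Icc (m + 1) N,
        (‖yhat j i - yd j i‖ ^ 2 - ‖yinf j i - yd j i‖ ^ 2) := by
        simp only [Finset.sum_sub_distrib]
        exact sub_le_sub_right hopt _
    _ ≤ ∑ _i ∈ Finset.Icc 1 S, ∑ j ∈ Finset.Icc (m + 1) N,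
        2 * (rY + rd) * C * hbar * lam ^ j :=
        Finset.sum_le_sum fun i hi => Finset.sum_le_sum (hterm i hi)
    _ = S * (2 * (rY + rd) * C * hbar * ∑ j ∈ Finset.Icc (m + 1) N, lam ^ j) := by
        simp [← Finset.mul_sum]
    _ ≤ S * (2 * (rY + rd) * C * hbar * (lam ^ (m + 1) / (1 - lam))) := by
        gcongr
        exact geom_sum_Icc_succ_le hlam₀.le hlam₁ m N
    _ = (2 * (rY + rd) * C * hbar * lam / (1 - lam)) * S * lam ^ m := by ring
end

section
/- Fix integers d ≥ 1, S ≥ 1, N ≥ 1, a burn-in parameter m with 0 ≤ m ≤ N−1, and reals r_Y, r_d ≥ 0, C > 0, λ ∈ (0,1), h̄ ≥ 0, ε > 1. Let y^d_{j|i}, y*_{j|i}, y∞_{j|i}, ŷ_{j|i} ∈ ℝ^d (for i ∈ {1,…,S}, j ∈ {1,…,N}) satisfy: (i) ‖y*_{j|i}‖ ≤ r_Y, ‖ŷ_{j|i}‖ ≤ r_Y, ‖y∞_{j|i}‖ ≤ r_Y and ‖y^d_{j|i}‖ ≤ r_d for all i, j; (ii) ‖ŷ_{j|i} − y∞_{j|i}‖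 ≤ C·λ^j·h̄ for all i, j; (iii) ∑_{i=1}^S ∑_{j=m+1}^N ‖y*_{j|i} − y^d_{j|i}‖² ≤ ∑_{i=1}^S ∑_{j=m+1}^N ‖ŷ_{j|i} − y^d_{j|i}‖²; (iv) ∑_{i=1}^S ∑_{j=m+1}^N 2⟨y∞_{j|i} − y^d_{j|i}, y*_{j|i} − y∞_{j|i}⟩ ≥ −(1/ε) ∑_{i=1}^S ∑_{j=m+1}^N ‖y*_{j|i} − y∞_{j|i}‖². Then ∑_{j=m+1}^N (1/S) ∑_{i=1}^S ‖y*_{j|i} − y∞_{j|i}‖² ≤ K·λ^m, where K := C̄·ε/(ε−1) and C̄ := 2(r_Y + r_d)·C·h̄·λ/(1−λ). -/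
open RealInnerProductSpace

theorem norm_sub_sq_le_of_norm_sub_le {E : Type*} [SeminormedAddCommGroup E]
    {a b c : E} {r s δ : ℝ} (ha : ‖a‖ ≤ r) (hb : ‖b‖ ≤ r) (hc : ‖c‖ ≤ s) (hab : ‖a - b‖ ≤ δ) :
    ‖a - c‖ ^ 2 ≤ ‖b - c‖ ^ 2 + 2 * (r + s) * δ := by
  have hac : ‖a - c‖ ≤ r + s := (norm_sub_le a c).trans (add_le_add ha hc)
  have hbc : ‖b - c‖ ≤ r + s := (norm_sub_le b c).trans (add_le_add hb hc)
  have hdiff : ‖a - c‖ - ‖b - c‖ ≤ δ := by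
    have h := norm_sub_norm_le (a - c) (b - c)
    rw [sub_sub_sub_cancel_right] at h
    exact h.trans hab
  have hδ : 0 ≤ δ := (norm_nonneg _).trans hab
  calc ‖a - c‖ ^ 2 = ‖b - c‖ ^ 2 + (‖a - c‖ + ‖b - c‖) * (‖a - c‖ - ‖b - c‖) := by ring
    _ ≤ ‖b - c‖ ^ 2 + (‖a - c‖ + ‖b - c‖) * δ := by gcongr
    _ ≤ ‖b - c‖ ^ 2 + 2 * (r + s) * δ := by
      gcongr
      linarith

theorem norm_sub_sq_eq_add_two_inner_add {E : Type*} [NormedAddCommGroup E]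
    [InnerProductSpace ℝ E] (a b c : E) :
    ‖a - c‖ ^ 2 = ‖b - c‖ ^ 2 + 2 * ⟪b - c, a - b⟫ + ‖a - b‖ ^ 2 := by
  rw [← norm_add_sq_real, add_comm, sub_add_sub_cancel]

theorem sum_Icc_succ_pow_le {x : ℝ} (h0 : 0 ≤ x) (h1 : x < 1) (m n : ℕ) :
    ∑ j ∈ Finset.Icc (m + 1) n, x ^ j ≤ x ^ m * x / (1 - x) := by
  rw [← pow_succ]
  exact geom_sum_Ico_le_of_lt_one (m := m + 1) (n := n + 1) h0 h1

/-- **Output turnpike property (Proposition 1).**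
Combining the stabilizability hypotheses (i)–(iii) with the coercivity hypothesis (iv),
the batch-averaged accumulated squared deviation of the TBPTT-optimal outputs `ystar`
from the turnpike `yinf` is bounded by `K λ^m`, with
`K = C̄ ε/(ε-1)` and `C̄ = 2(r_Y + r_d) C h̄ λ/(1-λ)`. -/
theorem output_turnpike
    (d S N m : ℕ) (hd : 1 ≤ d) (hS : 1 ≤ S) (hN : 1 ≤ N) (hm : m ≤ N - 1)
    (rY rd C lam hbar ε : ℝ) (hrY : 0 ≤ rY) (hrd : 0 ≤ rd) (hC : 0 < C)
    (hlam : lam ∈ Set.Ioo (0 : ℝ) 1) (hhbar : 0 ≤ hbar) (hε : 1 < ε)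
    (yd ystar yinf yhat : ℕ → ℕ → EuclideanSpace ℝ (Fin d))
    (hbound : ∀ i ∈ Finset.Icc 1 S, ∀ j ∈ Finset.Icc 1 N,
      ‖ystar j i‖ ≤ rY ∧ ‖yhat j i‖ ≤ rY ∧ ‖yinf j i‖ ≤ rY ∧ ‖yd j i‖ ≤ rd)
    (hconv : ∀ i ∈ Finset.Icc 1 S, ∀ j ∈ Finset.Icc 1 N,
      ‖yhat j i - yinf j i‖ ≤ C * lam ^ j * hbar)
    (hopt : ∑ i ∈ Finset.Icc 1 S, ∑ j ∈ Finset.Icc (m + 1) N, ‖ystar j i - yd j i‖ ^ 2 ≤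
            ∑ i ∈ Finset.Icc 1 S, ∑ j ∈ Finset.Icc (m + 1) N, ‖yhat j i - yd j i‖ ^ 2)
    (hvar : ∑ i ∈ Finset.Icc 1 S, ∑ j ∈ Finset.Icc (m + 1) N,
        2 * ⟪yinf j i - yd j i, ystar j i - yinf j i⟫ ≥
      -(1 / ε) * ∑ i ∈ Finset.Icc 1 S, ∑ j ∈ Finset.Icc (m + 1) N,
        ‖ystar j i - yinf j i‖ ^ 2) :
    ∑ j ∈ Finset.Icc (m + 1) N, (1 / (S : ℝ)) *
        ∑ i ∈ Finset.Icc 1 S, ‖ystar j i - yinf j i‖ ^ 2 ≤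
      ((2 * (rY + rd) * C * hbar * lam / (1 - lam)) * ε / (ε - 1)) * lam ^ m := by
  obtain ⟨hlam0, hlam1⟩ := hlam
  have hS0 : (0 : ℝ) < S := by exact_mod_cast hS
  have hexcess : ∑ i ∈ Finset.Icc 1 S, ∑ j ∈ Finset.Icc (m + 1) N, ‖yhat j i - yd j i‖ ^ 2 ≤
      ∑ i ∈ Finset.Icc 1 S, ∑ j ∈ Finset.Icc (m + 1) N,
        (‖yinf j i - yd j i‖ ^ 2 + 2 * (rY + rd) * (C * lam ^ j * hbar)) := by
    refine Finset.sum_le_sum fun i hi => Finset.sum_le_sum fun j hj => ?_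
    have hj' : j ∈ Finset.Icc 1 N := Finset.Icc_subset_Icc_left (Nat.le_add_left 1 m) hj
    obtain ⟨-, hyhat, hyinf, hyd⟩ := hbound i hi j hj'
    exact norm_sub_sq_le_of_norm_sub_le hyhat hyinf hyd (hconv i hi j hj')
  have hgeom : ∑ j ∈ Finset.Icc (m + 1) N, 2 * (rY + rd) * (C * lam ^ j * hbar) ≤
      2 * (rY + rd) * C * hbar * lam / (1 - lam) * lam ^ m := by
    calc ∑ j ∈ Finset.Icc (m + 1) N, 2 * (rY + rd) * (C * lam ^ j * hbar)
        = 2 * (rY + rd) * C * hbar * ∑ j ∈ Finset.Icc (m + 1) N, lam ^ j := by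
          rw [Finset.mul_sum]
          exact Finset.sum_congr rfl fun j _ => by ring
      _ ≤ 2 * (rY + rd) * C * hbar * (lam ^ m * lam / (1 - lam)) := by
          gcongr
          exact sum_Icc_succ_pow_le hlam0.le hlam1 m N
      _ = 2 * (rY + rd) * C * hbar * lam / (1 - lam) * lam ^ m := by ring
  have hexpand : ∑ i ∈ Finset.Icc 1 S, ∑ j ∈ Finset.Icc (m + 1) N, ‖ystar j i - yd j i‖ ^ 2 =
      ∑ i ∈ Finset.Icc 1 S, ∑ j ∈ Finset.Icc (m + 1) N, (‖yinf j i - yd j i‖ ^ 2 +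
        2 * ⟪yinf j i - yd j i, ystar j i - yinf j i⟫ + ‖ystar j i - yinf j i‖ ^ 2) :=
    Finset.sum_congr rfl fun i _ => Finset.sum_congr rfl fun j _ =>
      norm_sub_sq_eq_add_two_inner_add _ _ _
  simp only [Finset.sum_add_distrib] at hexcess hexpand
  rw [Finset.sum_const, Nat.card_Icc, Nat.add_sub_cancel, nsmul_eq_mul] at hexcess
  rw [← Finset.mul_sum, Finset.sum_comm]
  set D := ∑ i ∈ Finset.Icc 1 S, ∑ j ∈ Finset.Icc (m + 1) N, ‖ystar j i - yinf j i‖ ^ 2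
  set K := 2 * (rY + rd) * C * hbar * lam / (1 - lam)
  have hD : (1 - 1 / ε) * D ≤ S * (K * lam ^ m) := by
    have := mul_le_mul_of_nonneg_left hgeom hS0.le
    linarith
  have hε0 : 0 < ε - 1 := sub_pos.2 hε
  calc 1 / (S : ℝ) * D = 1 / S * (ε / (ε - 1)) * ((1 - 1 / ε) * D) := by
        field_simp
    _ ≤ 1 / S * (ε / (ε - 1)) * (S * (K * lam ^ m)) := by gcongr
    _ = K * ε / (ε - 1) * lam ^ m := by field_simp
end

section
/- Fix integers d ≥ 1, S ≥ 1, N ≥ 1 and a burn-in parameter m with 0 ≤ m ≤ N−1. Let y^d_{j|i}, y*_{j|i}, y^c_{j|i}, ŷ_{j|i} ∈ ℝ^d (for i ∈ {1,…,S}, j ∈ {1,…,N}) and reals r_Y, r_d ≥ 0, C > 0, λ ∈ (0,1), h̄ ≥ 0 satisfy: (i) ‖y*_{j|i}‖ ≤ r_Y, ‖ŷ_{j|i}‖ ≤ r_Y, ‖y^c_{j|i}‖ ≤ r_Y and ‖y^d_{j|i}‖ ≤ r_d for all i, j; (ii) ‖ŷ_{j|i} − y^c_{j|i}‖ ≤ C·λ^j·h̄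 for all i, j; (iii) ∑_{i=1}^S ∑_{j=m+1}^N ‖y*_{j|i} − y^d_{j|i}‖² ≤ ∑_{i=1}^S ∑_{j=m+1}^N ‖ŷ_{j|i} − y^d_{j|i}‖². Then J_S(Y*) − J_S(Y^c) ≤ C̄·λ^m/(N−m), where J_S(Y) := (1/(S(N−m))) ∑_{i=1}^S ∑_{j=m+1}^N ‖y_{j|i} − y^d_{j|i}‖² and C̄ := 2(r_Y + r_d)·C·h̄·λ/(1−λ). -/
/-- The squared distance to `z` is Lipschitz on a ball of radius `R`, with constant `2 (R + r)`
when `‖z‖ ≤ r`. -/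
lemma norm_sub_sq_sub_norm_sub_sq_le {E : Type*} [SeminormedAddCommGroup E] {x y z : E}
    {R r : ℝ} (hx : ‖x‖ ≤ R) (hy : ‖y‖ ≤ R) (hz : ‖z‖ ≤ r) :
    ‖x - z‖ ^ 2 - ‖y - z‖ ^ 2 ≤ 2 * (R + r) * ‖x - y‖ := by
  have hxz := norm_sub_le x z
  have hyz := norm_sub_le y z
  have htri : ‖x - z‖ - ‖y - z‖ ≤ ‖x - y‖ := by
    simpa using norm_sub_norm_le (x - z) (y - z)
  calc ‖x - z‖ ^ 2 - ‖y - z‖ ^ 2 = (‖x - z‖ + ‖y - z‖) * (‖x - z‖ - ‖y - z‖) := by ring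
    _ ≤ (‖x - z‖ + ‖y - z‖) * ‖x - y‖ := by gcongr
    _ ≤ 2 * (R + r) * ‖x - y‖ := by gcongr; linarith

lemma geom_sum_Icc_le_of_lt_one {x : ℝ} (hx : 0 ≤ x) (hx1 : x < 1) (m n : ℕ) :
    ∑ j ∈ Finset.Icc m n, x ^ j ≤ x ^ m / (1 - x) := by
  rw [← Finset.Ico_add_one_right_eq_Icc]
  exact geom_sum_Ico_le_of_lt_one hx hx1


/-- **Training regret (Corollary 1, part 2).**
With `J_S(Y) = (1/(S(N-m))) ∑_{i=1}^S ∑_{j=m+1}^N ‖y_{j|i} - y^d_{j|i}‖²`, the optimality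
gap of the TBPTT solution `ystar` relative to the benchmark `yc` is at most
`C̄ λ^m/(N-m)` with `C̄ = 2(r_Y + r_d) C h̄ λ/(1-λ)`. -/
theorem training_regret
    (d S N m : ℕ) (hd : 1 ≤ d) (hS : 1 ≤ S) (hN : 1 ≤ N) (hm : m ≤ N - 1)
    (yd ystar yc yhat : ℕ → ℕ → EuclideanSpace ℝ (Fin d))
    (rY rd C lam hbar : ℝ) (hrY : 0 ≤ rY) (hrd : 0 ≤ rd) (hC : 0 < C)
    (hlam : lam ∈ Set.Ioo (0 : ℝ) 1) (hhbar : 0 ≤ hbar)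
    (hbound : ∀ i ∈ Finset.Icc 1 S, ∀ j ∈ Finset.Icc 1 N,
      ‖ystar j i‖ ≤ rY ∧ ‖yhat j i‖ ≤ rY ∧ ‖yc j i‖ ≤ rY ∧ ‖yd j i‖ ≤ rd)
    (hconv : ∀ i ∈ Finset.Icc 1 S, ∀ j ∈ Finset.Icc 1 N,
      ‖yhat j i - yc j i‖ ≤ C * lam ^ j * hbar)
    (hopt : ∑ i ∈ Finset.Icc 1 S, ∑ j ∈ Finset.Icc (m + 1) N, ‖ystar j i - yd j i‖ ^ 2 ≤
            ∑ i ∈ Finset.Icc 1 S, ∑ j ∈ Finset.Icc (m + 1) N, ‖yhat j i - yd j i‖ ^ 2) :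
    (1 / ((S : ℝ) * ((N : ℝ) - (m : ℝ)))) *
        ∑ i ∈ Finset.Icc 1 S, ∑ j ∈ Finset.Icc (m + 1) N, ‖ystar j i - yd j i‖ ^ 2 -
      (1 / ((S : ℝ) * ((N : ℝ) - (m : ℝ)))) *
        ∑ i ∈ Finset.Icc 1 S, ∑ j ∈ Finset.Icc (m + 1) N, ‖yc j i - yd j i‖ ^ 2 ≤
      (2 * (rY + rd) * C * hbar * lam / (1 - lam)) * lam ^ m / ((N : ℝ) - (m : ℝ)) := by
  obtain ⟨hlam0, hlam1⟩ := hlam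
  have hmN : (0 : ℝ) < (N : ℝ) - m := sub_pos.2 (by exact_mod_cast (by omega : m < N))
  have hS0 : (0 : ℝ) < S := by exact_mod_cast hS
  have hgap : ∑ i ∈ Finset.Icc 1 S, ∑ j ∈ Finset.Icc (m + 1) N, ‖yhat j i - yd j i‖ ^ 2 -
      ∑ i ∈ Finset.Icc 1 S, ∑ j ∈ Finset.Icc (m + 1) N, ‖yc j i - yd j i‖ ^ 2 ≤
      S * (2 * (rY + rd) * C * hbar * (lam ^ (m + 1) / (1 - lam))) := by
    rw [← Finset.sum_sub_distrib]
    have hrow : ∀ i ∈ Finset.Icc 1 S,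
        ∑ j ∈ Finset.Icc (m + 1) N, ‖yhat j i - yd j i‖ ^ 2 -
          ∑ j ∈ Finset.Icc (m + 1) N, ‖yc j i - yd j i‖ ^ 2 ≤
        2 * (rY + rd) * C * hbar * (lam ^ (m + 1) / (1 - lam)) := by
      intro i hi
      rw [← Finset.sum_sub_distrib]
      calc ∑ j ∈ Finset.Icc (m + 1) N, (‖yhat j i - yd j i‖ ^ 2 - ‖yc j i - yd j i‖ ^ 2)
          ≤ ∑ j ∈ Finset.Icc (m + 1) N, 2 * (rY + rd) * C * hbar * lam ^ j := by
            refine Finset.sum_le_sum fun j hj => ?_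
            have hj' : j ∈ Finset.Icc 1 N := by
              rw [Finset.mem_Icc] at hj ⊢
              omega
            obtain ⟨-, hyhat, hyc, hyd⟩ := hbound i hi j hj'
            calc ‖yhat j i - yd j i‖ ^ 2 - ‖yc j i - yd j i‖ ^ 2
                ≤ 2 * (rY + rd) * ‖yhat j i - yc j i‖ :=
                  norm_sub_sq_sub_norm_sub_sq_le hyhat hyc hyd
              _ ≤ 2 * (rY + rd) * (C * lam ^ j * hbar) := by
                  gcongr
                  exact hconv i hi j hj'
              _ = 2 * (rY + rd) * C * hbar * lam ^ j := by ring
        _ = 2 * (rY + rd) * C * hbar * ∑ j ∈ Finset.Icc (m + 1) N, lam ^ j := by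
            rw [Finset.mul_sum]
        _ ≤ 2 * (rY + rd) * C * hbar * (lam ^ (m + 1) / (1 - lam)) := by
            gcongr
            exact geom_sum_Icc_le_of_lt_one hlam0.le hlam1 _ _
    simpa using Finset.sum_le_card_nsmul _ _ _ hrow
  rw [← mul_sub]
  calc _ ≤ 1 / ((S : ℝ) * ((N : ℝ) - m)) *
        (S * (2 * (rY + rd) * C * hbar * (lam ^ (m + 1) / (1 - lam)))) := by
        gcongr
        linarith
    _ = _ := by
        have hlam' : 1 - lam ≠ 0 := (sub_pos.2 hlam1).ne'
        field_simp
        ring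
end

section
/- Fix integers d ≥ 1, S ≥ 2, N ≥ 1, T ≥ N and a burn-in parameter m with 0 ≤ m ≤ N−1. Let s_1 < s_2 < … < s_S be integers with s_1 = 1, s_S = T − N + 1 and 1 ≤ s_i − s_{i−1} ≤ N for all 2 ≤ i ≤ S; set o_i := N − (s_i − s_{i−1}) for 2 ≤ i ≤ S and o_min := min_{2 ≤ i ≤ S} o_i, and assume m ≤ o_min. Let y*_t, y^b_t ∈ ℝ^d for t ∈ {1,…,T} and y*_{j|i}, y^c_{j|i} ∈ ℝ^d for i ∈ {1,…,S}, j ∈ {1,…,N}, and reals c₁ ≥ 0, K > 0, λ ∈ (0,1) satisfy: (a) y*_j = y*_{j|1} for all j ∈ {1,…,N}; (b) y^b_{s_i + j − 1} = y^c_{j|i} for all i ∈ {1,…,S}, j ∈ {1,…,N}; (c) ‖y*_{s_i + j − 1} − y*_{j|i}‖² ≤ c₁·λ^{2j} for all i ∈ {2,…,S}, j ∈ {1,…,N}; (d) ∑_{i=1}^S ∑_{j=m+1}^N ‖y*_{j|i} − y^c_{j|i}‖² ≤ 4·K·S·λ^m. Then ∑_{t=m+1}^T ‖y*_t − y^b_t‖²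 ≤ 2·c₂·(S−1)·λ^{2·o_min} + 8·K·S·λ^m, where c₂ := c₁·λ²/(1−λ²); in particular, with E₁ := 2·max{c₂, 4K}, one has (1/(T−m)) ∑_{t=m+1}^T ‖y*_t − y^b_t‖² ≤ E₁·((S−1)·λ^{2·o_min} + S·λ^m)/(T−m). -/
/-- A sum of nonnegative terms over `m + 1, …, s k + N - 1` is bounded by the sum over the first
window plus the sums over the last `N - o` indices of the windows `2, …, k`, as soon as consecutive
windows overlap in at least `o` indices. -/
theorem sum_Icc_le_sum_windows {f : ℕ → ℝ} (hf : ∀ t, 0 ≤ f t) {s : ℕ → ℕ} {m o N k : ℕ}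
    (hs1 : s 1 = 1) (hpos : ∀ i ∈ Finset.Icc 2 k, 1 ≤ s i) (hk : 1 ≤ k)
    (hstep : ∀ i ∈ Finset.Icc 2 k, s i + o ≤ s (i - 1) + N) :
    ∑ t ∈ Finset.Icc (m + 1) (s k + N - 1), f t ≤
      ∑ j ∈ Finset.Icc (m + 1) N, f j +
        ∑ i ∈ Finset.Icc 2 k, ∑ j ∈ Finset.Icc (o + 1) N, f (s i + j - 1) := by
  induction k, hk using Nat.le_induction with
  | base => simp [hs1]
  | succ k hk ih =>
    have ih := ih
      (fun i hi => hpos i (Finset.Icc_subset_Icc_right k.le_succ hi))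
      (fun i hi => hstep i (Finset.Icc_subset_Icc_right k.le_succ hi))
    have hlast : k + 1 ∈ Finset.Icc 2 (k + 1) := Finset.mem_Icc.mpr ⟨by omega, le_rfl⟩
    have hp := hpos _ hlast
    have hst : s (k + 1) + o ≤ s k + N := hstep _ hlast
    have hinj : Set.InjOn (fun j => s (k + 1) + j - 1) (Finset.Icc (o + 1) N) := by
      intro a _ b _ hab
      dsimp only at hab
      omega
    have hsub : Finset.Icc (m + 1) (s (k + 1) + N - 1) ⊆ Finset.Icc (m + 1) (s k + N - 1) ∪
        (Finset.Icc (o + 1) N).image (fun j => s (k + 1) + j - 1) := by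
      intro t ht
      rw [Finset.mem_Icc] at ht
      rw [Finset.mem_union, Finset.mem_Icc, Finset.mem_image]
      by_cases h : t ≤ s k + N - 1
      · exact Or.inl ⟨ht.1, h⟩
      · exact Or.inr ⟨t + 1 - s (k + 1), Finset.mem_Icc.mpr (by omega), by omega⟩
    have hunion := Finset.sum_union_inter (f := f) (s₁ := Finset.Icc (m + 1) (s k + N - 1))
      (s₂ := (Finset.Icc (o + 1) N).image (fun j => s (k + 1) + j - 1))
    rw [Finset.sum_image hinj] at hunion
    have hle := Finset.sum_le_sum_of_subset_of_nonneg hsub (fun t _ _ => hf t)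
    have hinter := Finset.sum_nonneg (s := Finset.Icc (m + 1) (s k + N - 1) ∩
      (Finset.Icc (o + 1) N).image (fun j => s (k + 1) + j - 1)) (fun t _ => hf t)
    rw [Finset.sum_Icc_succ_top (by omega)]
    linarith

/-- A tail of the geometric series in `x ^ 2`. -/
theorem sum_Icc_pow_two_mul_le {x : ℝ} (hx : x ∈ Set.Ioo (0 : ℝ) 1) (o N : ℕ) :
    ∑ j ∈ Finset.Icc (o + 1) N, x ^ (2 * j) ≤ x ^ 2 / (1 - x ^ 2) * x ^ (2 * o) := by
  have hlt : x ^ 2 < 1 := pow_lt_one₀ hx.1.le hx.2 two_ne_zero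
  have h := geom_sum_Ico_le_of_lt_one (m := o + 1) (n := N + 1) (sq_nonneg x) hlt
  rw [Finset.Ico_add_one_right_eq_Icc] at h
  simp only [pow_mul]
  refine h.trans_eq ?_
  ring

theorem norm_sub_sq_le_two_mul_add {E : Type*} [SeminormedAddCommGroup E] (a b c : E) :
    ‖a - c‖ ^ 2 ≤ 2 * ‖a - b‖ ^ 2 + 2 * ‖b - c‖ ^ 2 := by
  have h := pow_le_pow_left₀ (norm_nonneg _) (norm_sub_le_norm_sub_add_norm_sub a b c) 2
  linarith [add_sq_le (a := ‖a - b‖) (b := ‖b - c‖)]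


/-- **Averaged output accuracy over the full sequence (Theorem 3, part 1).**
A training sequence of length `T` is split into `S` windows of length `N` starting at
indices `s i`, with overlaps `o i = N - (s i - s (i-1))` and minimum overlap `omin ≥ m`.
`ystarT`/`ybT` are the TBPTT/benchmark outputs on the full sequence and `ystar`/`yc`
the corresponding segment outputs.  Hypothesis `hstab` encodes incremental output
stability and `hturn` the turnpike bound from Corollary 1.  Then the accumulated squared
deviation is bounded by `2 c₂ (S-1) λ^{2 omin} + 8 K S λ^m` with `c₂ = c₁ λ²/(1-λ²)`,
and in particular the averaged deviation by
`E₁ ((S-1) λ^{2 omin} + S λ^m)/(T-m)` with `E₁ = 2 max{c₂, 4K}`. -/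
theorem averaged_output_accuracy
    (d S N T m : ℕ) (hd : 1 ≤ d) (hS : 2 ≤ S) (hN : 1 ≤ N) (hT : N ≤ T) (hm : m ≤ N - 1)
    (s : ℕ → ℕ) (hmono : ∀ i ∈ Finset.Icc 2 S, s (i - 1) < s i)
    (hs1 : s 1 = 1) (hsS : s S = T - N + 1)
    (hstep : ∀ i ∈ Finset.Icc 2 S, 1 ≤ s i - s (i - 1) ∧ s i - s (i - 1) ≤ N)
    (omin : ℕ)
    (homin : omin = (Finset.Icc 2 S).inf' (Finset.nonempty_Icc.mpr hS)
      (fun i => N - (s i - s (i - 1))))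
    (hmomin : m ≤ omin)
    (ystarT ybT : ℕ → EuclideanSpace ℝ (Fin d))
    (ystar yc : ℕ → ℕ → EuclideanSpace ℝ (Fin d))
    (c₁ K lam : ℝ) (hc₁ : 0 ≤ c₁) (hK : 0 < K) (hlam : lam ∈ Set.Ioo (0 : ℝ) 1)
    (hfirst : ∀ j ∈ Finset.Icc 1 N, ystarT j = ystar j 1)
    (hbench : ∀ i ∈ Finset.Icc 1 S, ∀ j ∈ Finset.Icc 1 N, ybT (s i + j - 1) = yc j i)
    (hstab : ∀ i ∈ Finset.Icc 2 S, ∀ j ∈ Finset.Icc 1 N,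
      ‖ystarT (s i + j - 1) - ystar j i‖ ^ 2 ≤ c₁ * lam ^ (2 * j))
    (hturn : ∑ i ∈ Finset.Icc 1 S, ∑ j ∈ Finset.Icc (m + 1) N,
      ‖ystar j i - yc j i‖ ^ 2 ≤ 4 * K * (S : ℝ) * lam ^ m) :
    (∑ t ∈ Finset.Icc (m + 1) T, ‖ystarT t - ybT t‖ ^ 2 ≤
        2 * (c₁ * lam ^ 2 / (1 - lam ^ 2)) * ((S : ℝ) - 1) * lam ^ (2 * omin) +
          8 * K * (S : ℝ) * lam ^ m) ∧
      (1 / ((T : ℝ) - (m : ℝ))) * ∑ t ∈ Finset.Icc (m + 1) T, ‖ystarT t - ybT t‖ ^ 2 ≤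
        (2 * max (c₁ * lam ^ 2 / (1 - lam ^ 2)) (4 * K)) *
          (((S : ℝ) - 1) * lam ^ (2 * omin) + (S : ℝ) * lam ^ m) / ((T : ℝ) - (m : ℝ)) := by
  have hlast_mem : S ∈ Finset.Icc 2 S := Finset.mem_Icc.mpr ⟨hS, le_rfl⟩
  have hfirst_mem : 1 ∈ Finset.Icc 1 S := Finset.mem_Icc.mpr ⟨le_rfl, by omega⟩
  have hoverlap : ∀ i ∈ Finset.Icc 2 S, omin ≤ N - (s i - s (i - 1)) := fun i hi =>
    homin ▸ Finset.inf'_le (fun i => N - (s i - s (i - 1))) hi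
  have hcover := sum_Icc_le_sum_windows (f := fun t => ‖ystarT t - ybT t‖ ^ 2) (m := m)
    (o := omin) (N := N) (fun t => sq_nonneg _) hs1
    (fun i hi => by have := hmono i hi; omega) (by omega : 1 ≤ S)
    (fun i hi => by have := hstep i hi; have := hoverlap i hi; omega)
  rw [show s S + N - 1 = T by omega] at hcover
  set e : ℕ → ℝ := fun i => ∑ j ∈ Finset.Icc (m + 1) N, ‖ystar j i - yc j i‖ ^ 2
  set c₂ : ℝ := c₁ * lam ^ 2 / (1 - lam ^ 2) with hc₂
  have he : ∀ i, 0 ≤ e i := fun i => Finset.sum_nonneg fun j _ => sq_nonneg _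
  have hwindow_one : ∑ j ∈ Finset.Icc (m + 1) N, ‖ystarT j - ybT j‖ ^ 2 = e 1 := by
    refine Finset.sum_congr rfl fun j hj => ?_
    have hj' : j ∈ Finset.Icc 1 N := Finset.Icc_subset_Icc_left (by omega) hj
    have hb := hbench 1 hfirst_mem j hj'
    rw [hs1, Nat.add_sub_cancel_left] at hb
    rw [hfirst j hj', hb]
  have hwindow : ∀ i ∈ Finset.Icc 2 S, ∑ j ∈ Finset.Icc (omin + 1) N,
      ‖ystarT (s i + j - 1) - ybT (s i + j - 1)‖ ^ 2 ≤
        2 * c₂ * lam ^ (2 * omin) + 2 * e i := by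
    intro i hi
    calc _ ≤ ∑ j ∈ Finset.Icc (omin + 1) N,
          (2 * c₁ * lam ^ (2 * j) + 2 * ‖ystar j i - yc j i‖ ^ 2) := by
          refine Finset.sum_le_sum fun j hj => ?_
          have hj' : j ∈ Finset.Icc 1 N := Finset.Icc_subset_Icc_left (by omega) hj
          rw [hbench i (Finset.Icc_subset_Icc_left one_le_two hi) j hj']
          linarith [norm_sub_sq_le_two_mul_add (ystarT (s i + j - 1)) (ystar j i) (yc j i),
            hstab i hi j hj']
      _ = 2 * c₁ * ∑ j ∈ Finset.Icc (omin + 1) N, lam ^ (2 * j) +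
          2 * ∑ j ∈ Finset.Icc (omin + 1) N, ‖ystar j i - yc j i‖ ^ 2 := by
          rw [Finset.sum_add_distrib, Finset.mul_sum, Finset.mul_sum]
      _ ≤ 2 * c₁ * (lam ^ 2 / (1 - lam ^ 2) * lam ^ (2 * omin)) + 2 * e i := by
          gcongr
          · exact sum_Icc_pow_two_mul_le hlam omin N
          · exact Finset.sum_le_sum_of_subset_of_nonneg
              (Finset.Icc_subset_Icc_left (by omega)) fun j _ _ => sq_nonneg _
      _ = _ := by rw [hc₂]; ring
  have hsplit : ∑ i ∈ Finset.Icc 1 S, e i = e 1 + ∑ i ∈ Finset.Icc 2 S, e i :=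
    (Finset.add_sum_Ioc_eq_sum_Icc (f := e) (by omega : 1 ≤ S)).symm
  have hsum := Finset.sum_le_sum hwindow
  rw [Finset.sum_add_distrib, Finset.sum_const, ← Finset.mul_sum, Nat.card_Icc, nsmul_eq_mul,
    show S + 1 - 2 = S - 1 by omega, Nat.cast_sub (by omega), Nat.cast_one] at hsum
  have hmain : ∑ t ∈ Finset.Icc (m + 1) T, ‖ystarT t - ybT t‖ ^ 2 ≤
      2 * c₂ * ((S : ℝ) - 1) * lam ^ (2 * omin) + 8 * K * (S : ℝ) * lam ^ m := by
    linarith [he 1]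
  refine ⟨hmain, ?_⟩
  have hSpos : (0 : ℝ) ≤ (S : ℝ) - 1 := by
    rw [sub_nonneg]
    exact_mod_cast (by omega : 1 ≤ S)
  have hTm : (0 : ℝ) < (T : ℝ) - m := by
    rw [sub_pos]
    exact_mod_cast (by omega : m < T)
  have hlam0 := hlam.1.le
  rw [one_div_mul_eq_div]
  gcongr
  have h₁ := mul_le_mul_of_nonneg_right (le_max_left c₂ (4 * K))
    (mul_nonneg hSpos (pow_nonneg hlam0 (2 * omin)))
  have h₂ := mul_le_mul_of_nonneg_right (le_max_right c₂ (4 * K))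
    (mul_nonneg S.cast_nonneg (pow_nonneg hlam0 m))
  linarith
end
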